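/- Let n ≥ 2 and let A₁, …, Aₙ be bounded operators on a complex Hilbert space H such that |Aᵢ| commutes with Aⱼ whenever i < j. Then the operators |A₁|, …, |Aₙ| mutually commute and |A₁⋯Aₙ| = |A₁|⋯|Aₙ|. -/

import Mathlib

open ContinuousLinearMap

/-- The modulus `|A| = (A*A)^{1/2}` of a bounded operator on a Hilbert space. -/
noncomputable def modulus {H : Type*} [NormedAddCommGroup H] [InnerProductSpace ℂ H]
    [CompleteSpace H] (A : H →L[ℂ] H) : H →L[ℂ] H :=
  CFC.sqrt (adjoint A * A)

theorem modulus_eq_abs {H : Type*} [NormedAddCommGroup H] [InnerProductSpace ℂ H]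
    [CompleteSpace H] (A : H →L[ℂ] H) : modulus A = CFC.abs A := rfl

theorem commute_modulus_star {H : Type*} [NormedAddCommGroup H] [InnerProductSpace ℂ H]
    [CompleteSpace H] {A B : H →L[ℂ] H} (h : Commute (modulus A) B) :
    Commute (modulus A) (star B) := by
  have hsa : star (modulus A) = modulus A := by
    rw [modulus_eq_abs]
    exact (CFC.abs_nonneg A).isSelfAdjoint.star_eq
  have := h.star_star
  rwa [hsa] at this

theorem commute_modulus_modulus {H : Type*} [NormedAddCommGroup H] [InnerProductSpace ℂ H]
    [CompleteSpace H] {A B : H →L[ℂ] H} (h : Commute (modulus A) B) :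
    Commute (modulus A) (modulus B) := by
  have h2 := commute_modulus_star h
  rw [modulus_eq_abs B]
  exact (((h2.mul_right h).symm.cfcₙ_nnreal _).symm : _)

theorem modulus_mul {H : Type*} [NormedAddCommGroup H] [InnerProductSpace ℂ H]
    [CompleteSpace H] {A B : H →L[ℂ] H} (h : Commute (modulus A) B) :
    modulus (A * B) = modulus A * modulus B := by
  have hc := commute_modulus_modulus h
  have h2 := commute_modulus_star h
  have hA : modulus A * modulus A = star A * A := CFC.abs_mul_abs A
  have hB : modulus B * modulus B = star B * B := CFC.abs_mul_abs B
  refine CFC.sqrt_unique ?_ (hc.mul_nonneg (CFC.abs_nonneg A) (CFC.abs_nonneg B))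
  change _ = star (A * B) * (A * B)
  calc modulus A * modulus B * (modulus A * modulus B)
      = (modulus A * modulus A) * (modulus B * modulus B) := hc.symm.mul_mul_mul_comm _ _
    _ = (modulus A * modulus A) * star B * B := by rw [hB]; simp only [mul_assoc]
    _ = star B * (modulus A * modulus A) * B := by rw [(h2.mul_left h2).eq]
    _ = star (A * B) * (A * B) := by rw [hA, star_mul]; simp only [mul_assoc]

theorem modulus_list_prod_aux {H : Type*} [NormedAddCommGroup H]
    [InnerProductSpace ℂ H] [CompleteSpace H] (n : ℕ)
    (A : Fin n → (H →L[ℂ] H))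
    (h : ∀ i j : Fin n, i < j → Commute (modulus (A i)) (A j)) :
    modulus (List.ofFn A).prod = (List.ofFn fun i => modulus (A i)).prod := by
  induction n with
  | zero => simp [modulus_eq_abs]
  | succ n ih =>
    rw [List.ofFn_succ, List.ofFn_succ, List.prod_cons, List.prod_cons, modulus_mul,
      ih (fun i => A i.succ) (fun i j hij => h _ _ (Fin.succ_lt_succ_iff.mpr hij))]
    apply Commute.list_prod_right
    intro x hx
    obtain ⟨i, rfl⟩ := (List.mem_ofFn' _ _).mp hx
    exact h _ _ (Fin.succ_pos i)

/-- Let `n ≥ 2` and `A₀, …, A_{n-1}` be bounded operators such that `|Aᵢ|` commutes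
with `Aⱼ` whenever `i < j`. Then the moduli `|Aᵢ|` mutually commute and
`|A₀ ⋯ A_{n-1}| = |A₀| ⋯ |A_{n-1}|`. -/
theorem modulus_list_prod {H : Type*} [NormedAddCommGroup H]
    [InnerProductSpace ℂ H] [CompleteSpace H] (n : ℕ) (hn : 2 ≤ n)
    (A : Fin n → (H →L[ℂ] H))
    (h : ∀ i j : Fin n, i < j → modulus (A i) * A j = A j * modulus (A i)) :
    (∀ i j : Fin n, Commute (modulus (A i)) (modulus (A j))) ∧
      modulus (List.ofFn A).prod = (List.ofFn fun i => modulus (A i)).prod := by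
  refine ⟨fun i j => ?_, modulus_list_prod_aux n A h⟩
  rcases lt_trichotomy i j with hij | hij | hij
  · exact commute_modulus_modulus (h i j hij)
  · rw [hij]
  · exact (commute_modulus_modulus (h j i hij)).symm
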